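/- Under the hypotheses of the MPC value-decrease result — f : ℝⁿ × ℝᵐ → ℝⁿ, U ⊆ ℝᵐ, X_f ⊆ ℝⁿ positively invariant under an auxiliary law k with values in U, nonnegative stage cost l and nonnegative terminal cost V_f with V_f(f(x,k(x))) ≤ V_f(x) − l(x,k(x)) on X_f — suppose the closed-loop trajectory (x_t)_{t∈ℕ} is generated by x_{t+1} = f(x_t, u*_0(x_t)), where at each t the applied control u*_0(x_t) is the first element of a control sequence that is feasible from x_t and attains the optimal value J*(x_t). Then t ↦ J*(x_t) is nonincreasing and converges, ∑_{t=0}^{T−1} l(x_t, u*_0(x_t)) ≤ J*(x_0) for every T, and the closed-loop stage cost l(x_t, u*_0(x_t)) tends to 0 as t → ∞. -/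

import Mathlib

/-- The trajectory of the discrete-time controlled system `x_{i+1} = f (x_i) (u_i)`
starting from `x` under the control sequence `u`. -/
def traj {n m : ℕ} (f : (Fin n → ℝ) → (Fin m → ℝ) → (Fin n → ℝ))
    (x : Fin n → ℝ) (u : ℕ → Fin m → ℝ) : ℕ → Fin n → ℝ
  | 0 => x
  | i + 1 => f (traj f x u i) (u i)

/-- A horizon-`N` control sequence `u` is feasible from `x` if all its controls lie in
`U` and the resulting state after `N` steps lies in the terminal set `Xf`. -/
def Feasible {n m : ℕ} (f : (Fin n → ℝ) → (Fin m → ℝ) → (Fin n → ℝ))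
    (U : Set (Fin m → ℝ)) (Xf : Set (Fin n → ℝ)) (N : ℕ)
    (x : Fin n → ℝ) (u : ℕ → Fin m → ℝ) : Prop :=
  (∀ i < N, u i ∈ U) ∧ traj f x u N ∈ Xf

/-- The finite-horizon cost `J_N(x, u) = ∑_{i<N} l(x_i, u_i) + V_f(x_N)`. -/
def costJ {n m : ℕ} (f : (Fin n → ℝ) → (Fin m → ℝ) → (Fin n → ℝ))
    (l : (Fin n → ℝ) → (Fin m → ℝ) → ℝ) (Vf : (Fin n → ℝ) → ℝ) (N : ℕ)
    (x : Fin n → ℝ) (u : ℕ → Fin m → ℝ) : ℝ :=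
  (∑ i ∈ Finset.range N, l (traj f x u i) (u i)) + Vf (traj f x u N)

/-- The MPC optimal value function `J*(x)`: the infimum of `J_N(x, u)` over feasible
control sequences `u`. -/
noncomputable def Jstar {n m : ℕ} (f : (Fin n → ℝ) → (Fin m → ℝ) → (Fin n → ℝ))
    (U : Set (Fin m → ℝ)) (Xf : Set (Fin n → ℝ))
    (l : (Fin n → ℝ) → (Fin m → ℝ) → ℝ) (Vf : (Fin n → ℝ) → ℝ) (N : ℕ)
    (x : Fin n → ℝ) : ℝ :=
  sInf {c : ℝ | ∃ u : ℕ → Fin m → ℝ, Feasible f U Xf N x u ∧ costJ f l Vf N x u = c}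

theorem traj_succ_eq_traj_tail {n m : ℕ} (f : (Fin n → ℝ) → (Fin m → ℝ) → (Fin n → ℝ))
    (x : Fin n → ℝ) (u : ℕ → Fin m → ℝ) (i : ℕ) :
    traj f x u (i + 1) = traj f (f x (u 0)) (fun j => u (j + 1)) i := by
  induction i with
  | zero => rfl
  | succ i ih =>
    rw [traj, ih, traj]

theorem traj_congr {n m : ℕ} (f : (Fin n → ℝ) → (Fin m → ℝ) → (Fin n → ℝ))
    (x : Fin n → ℝ) {u v : ℕ → Fin m → ℝ} {i : ℕ} (h : ∀ j < i, u j = v j) :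
    traj f x u i = traj f x v i := by
  induction i with
  | zero => rfl
  | succ i ih =>
    rw [traj, traj, ih fun j hj => h j (hj.trans i.lt_succ_self), h i i.lt_succ_self]

theorem Jstar_le_costJ {n m : ℕ} {f : (Fin n → ℝ) → (Fin m → ℝ) → (Fin n → ℝ)}
    {U : Set (Fin m → ℝ)} {Xf : Set (Fin n → ℝ)}
    {l : (Fin n → ℝ) → (Fin m → ℝ) → ℝ} {Vf : (Fin n → ℝ) → ℝ}
    (hl : ∀ x u, 0 ≤ l x u) (hVf : ∀ x, 0 ≤ Vf x) {N : ℕ}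
    {x : Fin n → ℝ} {u : ℕ → Fin m → ℝ} (hu : Feasible f U Xf N x u) :
    Jstar f U Xf l Vf N x ≤ costJ f l Vf N x u := by
  refine csInf_le ⟨0, ?_⟩ ⟨u, hu, rfl⟩
  rintro _ ⟨v, -, rfl⟩
  exact add_nonneg (Finset.sum_nonneg fun i _ => hl _ _) (hVf _)

/-- Dropping the first control of a feasible sequence and appending the auxiliary law yields a
feasible sequence from the successor state whose cost is lower by at least the first stage cost. -/
theorem exists_feasible_costJ_add_le {n m : ℕ} {f : (Fin n → ℝ) → (Fin m → ℝ) → (Fin n → ℝ)}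
    {U : Set (Fin m → ℝ)} {Xf : Set (Fin n → ℝ)} {k : (Fin n → ℝ) → (Fin m → ℝ)}
    {l : (Fin n → ℝ) → (Fin m → ℝ) → ℝ} {Vf : (Fin n → ℝ) → ℝ}
    (hk : ∀ x ∈ Xf, k x ∈ U ∧ f x (k x) ∈ Xf)
    (hdec : ∀ x ∈ Xf, Vf (f x (k x)) ≤ Vf x - l x (k x))
    {N : ℕ} (hN : 1 ≤ N) {x : Fin n → ℝ} {u : ℕ → Fin m → ℝ} (hu : Feasible f U Xf N x u) :
    ∃ v, Feasible f U Xf N (f x (u 0)) v ∧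
      costJ f l Vf N (f x (u 0)) v + l x (u 0) ≤ costJ f l Vf N x u := by
  obtain ⟨M, rfl⟩ : ∃ M, N = M + 1 := ⟨N - 1, by omega⟩
  obtain ⟨huU, huX⟩ := hu
  set z := traj f x u (M + 1) with hz
  let v : ℕ → Fin m → ℝ := fun i => if i < M then u (i + 1) else k z
  have hv : ∀ i < M, v i = u (i + 1) := fun i hi => if_pos hi
  have hvM : v M = k z := if_neg (lt_irrefl M)
  have htraj : ∀ i ≤ M, traj f (f x (u 0)) v i = traj f x u (i + 1) := fun i hi => by
    rw [traj_succ_eq_traj_tail]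
    exact traj_congr f _ fun j hj => hv j (hj.trans_le hi)
  have hend : traj f (f x (u 0)) v (M + 1) = f z (k z) := by
    rw [traj, htraj M le_rfl, hvM]
  refine ⟨v, ⟨fun i hi => ?_, hend ▸ (hk z huX).2⟩, ?_⟩
  · rcases Nat.lt_succ_iff_lt_or_eq.mp hi with h | rfl
    · rw [hv i h]
      exact huU _ (by omega)
    · rw [hvM]
      exact (hk z huX).1
  · have hsum : ∑ i ∈ Finset.range M, l (traj f (f x (u 0)) v i) (v i) =
        ∑ i ∈ Finset.range M, l (traj f x u (i + 1)) (u (i + 1)) :=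
      Finset.sum_congr rfl fun i hi => by
        have hi := Finset.mem_range.mp hi
        rw [htraj i hi.le, hv i hi]
    have hd := hdec z huX
    rw [costJ, costJ, hend, Finset.sum_range_succ, hsum, htraj M le_rfl, hvM, ← hz,
      Finset.sum_range_succ', show traj f x u 0 = x from rfl]
    linarith

/-- Convergence of the MPC closed loop (no attacks): under positive invariance of `Xf`
under the auxiliary law `k` (with values in `U`), nonnegative stage cost `l`,
nonnegative terminal cost `Vf` with the terminal decrease condition on `Xf`, if the
closed-loop trajectory `x_{t+1} = f (x_t) (u0 t)` applies at each `t` the first element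
`u0 t` of a control sequence that is feasible from `x t` and attains `J*(x t)`, then
`t ↦ J*(x t)` is nonincreasing and converges, the closed-loop stage costs have partial
sums bounded by `J*(x 0)`, and the closed-loop stage cost tends to `0`. -/
theorem mpc_closed_loop_convergence {n m : ℕ}
    (f : (Fin n → ℝ) → (Fin m → ℝ) → (Fin n → ℝ))
    (U : Set (Fin m → ℝ)) (Xf : Set (Fin n → ℝ)) (k : (Fin n → ℝ) → (Fin m → ℝ))
    (l : (Fin n → ℝ) → (Fin m → ℝ) → ℝ) (Vf : (Fin n → ℝ) → ℝ)
    (hk : ∀ x ∈ Xf, k x ∈ U ∧ f x (k x) ∈ Xf)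
    (hl : ∀ x u, 0 ≤ l x u) (hVf : ∀ x, 0 ≤ Vf x)
    (hdec : ∀ x ∈ Xf, Vf (f x (k x)) ≤ Vf x - l x (k x))
    (N : ℕ) (hN : 1 ≤ N)
    (x : ℕ → Fin n → ℝ) (u0 : ℕ → Fin m → ℝ)
    (hloop : ∀ t, x (t + 1) = f (x t) (u0 t))
    (hopt : ∀ t, ∃ useq : ℕ → Fin m → ℝ,
      Feasible f U Xf N (x t) useq ∧ useq 0 = u0 t ∧
      costJ f l Vf N (x t) useq = Jstar f U Xf l Vf N (x t)) :
    Antitone (fun t => Jstar f U Xf l Vf N (x t)) ∧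
    (∃ Jbar : ℝ,
      Filter.Tendsto (fun t => Jstar f U Xf l Vf N (x t)) Filter.atTop (nhds Jbar)) ∧
    (∀ T : ℕ, ∑ t ∈ Finset.range T, l (x t) (u0 t) ≤ Jstar f U Xf l Vf N (x 0)) ∧
    Filter.Tendsto (fun t => l (x t) (u0 t)) Filter.atTop (nhds 0) := by
  have hnonneg : ∀ t, 0 ≤ Jstar f U Xf l Vf N (x t) := fun t =>
    Real.sInf_nonneg fun c ⟨_, _, hc⟩ =>
      hc ▸ add_nonneg (Finset.sum_nonneg fun i _ => hl _ _) (hVf _)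
  have hstep : ∀ t, Jstar f U Xf l Vf N (x (t + 1)) + l (x t) (u0 t) ≤
      Jstar f U Xf l Vf N (x t) := fun t => by
    obtain ⟨u, hu, hu0, hcost⟩ := hopt t
    obtain ⟨v, hv, hle⟩ := exists_feasible_costJ_add_le hk hdec hN hu
    rw [hu0, ← hloop] at hle
    rw [hu0, ← hloop] at hv
    have := Jstar_le_costJ hl hVf hv
    linarith
  have hanti : Antitone (fun t => Jstar f U Xf l Vf N (x t)) :=
    antitone_nat_of_succ_le fun t => by linarith [hstep t, hl (x t) (u0 t)]
  have hsum : ∀ T : ℕ, ∑ t ∈ Finset.range T, l (x t) (u0 t) ≤ Jstar f U Xf l Vf N (x 0) := by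
    intro T
    have : ∑ t ∈ Finset.range T, l (x t) (u0 t) ≤
        Jstar f U Xf l Vf N (x 0) - Jstar f U Xf l Vf N (x T) := by
      rw [← Finset.sum_range_sub' (fun t => Jstar f U Xf l Vf N (x t))]
      exact Finset.sum_le_sum fun t _ => by linarith [hstep t]
    linarith [hnonneg T]
  refine ⟨hanti, ⟨_, tendsto_atTop_ciInf hanti ⟨0, ?_⟩⟩, hsum, ?_⟩
  · rintro _ ⟨t, rfl⟩
    exact hnonneg t
  · exact (summable_of_sum_range_le (fun t => hl _ _) hsum).tendsto_atTop_zero
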